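/- Write μ = m² with m ≥ 0. Under the saddle-node hypotheses (f C^r, r ≥ 3, f(0,0)=0, f_x(0,0)=1, f_μ(0,0)>0, f_{xx}(0,0)<0), the two fixed points of f(·, m²) for small m > 0 admit expansions x_k(m) = (−1)^k √(−2 f_μ / f_{xx})|₀ · m + O(m²) for k = 1, 2, where the functions x_k are C^{r−2} in m (including at m = 0). -/

import Mathlib

open Set

theorem aux_fderiv_integral {E : Type} [NormedAddCommGroup E] [NormedSpace ℝ E]
    [CompleteSpace E] (K : (ℝ × ℝ) × ℝ → E) (hK : ContDiff ℝ 1 K) (p : ℝ × ℝ) :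
    HasFDerivAt (fun p => ∫ t in (0:ℝ)..1, K (p, t))
      (∫ t in (0:ℝ)..1, (fderiv ℝ K (p, t)).comp (ContinuousLinearMap.inl ℝ (ℝ × ℝ) ℝ)) p := by
  have hc : Continuous (fun q : (ℝ × ℝ) × ℝ =>
      (fderiv ℝ K q).comp (ContinuousLinearMap.inl ℝ (ℝ × ℝ) ℝ)) := by
    have := hK.continuous_fderiv one_ne_zero
    fun_prop
  have hcomp : IsCompact (Metric.closedBall p 1 ×ˢ Icc (0:ℝ) 1) :=
    (isCompact_closedBall p 1).prod isCompact_Icc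
  obtain ⟨C, hC⟩ := hcomp.exists_bound_of_continuousOn hc.continuousOn
  refine intervalIntegral.hasFDerivAt_integral_of_dominated_of_fderiv_le
    (F := fun p t => K (p, t)) 
    (F' := fun p t => (fderiv ℝ K (p, t)).comp (ContinuousLinearMap.inl ℝ (ℝ × ℝ) ℝ))
    (bound := fun _ => C) (s := Metric.ball p 1)
    (Metric.ball_mem_nhds p one_pos) ?_ ?_ ?_ ?_ ?_ ?_
  · refine Filter.Eventually.of_forall fun x => ?_
    have := hK.continuous
    exact (by fun_prop : Continuous fun t => K (x, t)).aestronglyMeasurable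
  · have := hK.continuous
    exact (by fun_prop : Continuous fun t => K (p, t)).intervalIntegrable _ _
  · exact (hc.comp (by fun_prop : Continuous fun t : ℝ => (p, t))).aestronglyMeasurable
  · refine Filter.Eventually.of_forall fun t ht x hx => ?_
    rw [uIoc_of_le zero_le_one] at ht
    exact hC (x, t) ⟨Metric.ball_subset_closedBall hx, ht.1.le, ht.2⟩
  · exact intervalIntegrable_const
  · refine Filter.Eventually.of_forall fun t ht x hx => ?_
    have h1 : HasFDerivAt K (fderiv ℝ K (x, t)) (x, t) :=
      (hK.differentiable one_ne_zero _).hasFDerivAt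
    exact h1.comp x (hasFDerivAt_prodMk_left x t)

theorem aux_contDiff_integral (n : ℕ) : ∀ {E : Type} [NormedAddCommGroup E] [NormedSpace ℝ E]
    [CompleteSpace E] (K : (ℝ × ℝ) × ℝ → E) (_ : ContDiff ℝ n K),
    ContDiff ℝ n (fun p => ∫ t in (0:ℝ)..1, K (p, t)) := by
  induction n with
  | zero =>
    intro E _ _ _ K hK
    have h := hK.continuous
    simp only [Nat.cast_zero, contDiff_zero]
    exact intervalIntegral.continuous_parametric_intervalIntegral_of_continuous' 
      (f := fun p t => K (p, t)) h 0 1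
  | succ n ih =>
    intro E _ _ _ K hK
    have h1 : ContDiff ℝ 1 K := hK.of_le (by exact_mod_cast Nat.le_add_left 1 n)
    have hd := aux_fderiv_integral K h1
    have : ((n + 1 : ℕ) : WithTop ℕ∞) = n + 1 := by norm_cast
    rw [this] at hK ⊢
    rw [contDiff_succ_iff_fderiv]
    refine ⟨fun p => (hd p).differentiableAt, by simp, ?_⟩
    have he : fderiv ℝ (fun p => ∫ t in (0:ℝ)..1, K (p, t)) = fun p =>
      ∫ t in (0:ℝ)..1, (fderiv ℝ K (p, t)).comp (ContinuousLinearMap.inl ℝ (ℝ × ℝ) ℝ) :=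
      funext fun p => (hd p).fderiv
    rw [he]
    refine ih (fun q => (fderiv ℝ K q).comp (ContinuousLinearMap.inl ℝ (ℝ × ℝ) ℝ)) ?_
    exact (hK.fderiv_right le_rfl).clm_comp contDiff_const

theorem aux_hadamard (n : ℕ) (h : ℝ × ℝ → ℝ) (hh : ContDiff ℝ (n + 1 : ℕ) h)
    (h0 : ∀ y, h (0, y) = 0) :
    ∃ k : ℝ × ℝ → ℝ, ContDiff ℝ n k ∧ ∀ m y, h (m, y) = m * k (m, y) := by
  have hd : ContDiff ℝ n (fderiv ℝ h) := hh.fderiv_right (by norm_cast)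
  refine ⟨fun p => ∫ t in (0:ℝ)..1, (fderiv ℝ h (t * p.1, p.2)) (1, 0), ?_, ?_⟩
  · refine aux_contDiff_integral n (fun q => (fderiv ℝ h (q.2 * q.1.1, q.1.2)) (1, 0)) ?_
    exact (hd.comp (by fun_prop : ContDiff ℝ n
      fun q : (ℝ × ℝ) × ℝ => (q.2 * q.1.1, q.1.2))).clm_apply contDiff_const
  · intro m y
    have hder : ∀ t ∈ uIcc (0:ℝ) 1, HasDerivAt (fun t => h (t * m, y))
        (m * (fderiv ℝ h (t * m, y)) (1, 0)) t := by
      intro t _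
      have h1 : HasFDerivAt h (fderiv ℝ h (t * m, y)) (t * m, y) :=
        (hh.differentiable (by norm_cast) _).hasFDerivAt
      have h2 : HasDerivAt (fun t : ℝ => (t * m, y)) (m, 0) t :=
        (hasDerivAt_mul_const m).prodMk (hasDerivAt_const t y)
      have h3 := h1.comp_hasDerivAt t h2
      have h4 : ((m, 0) : ℝ × ℝ) = m • (1, 0) := by simp
      rw [h4, map_smul, smul_eq_mul] at h3
      exact h3
    have hi := intervalIntegral.integral_eq_sub_of_hasDerivAt hder (by
      apply Continuous.intervalIntegrable
      have := hd.continuous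
      fun_prop)
    rw [intervalIntegral.integral_const_mul] at hi
    simp only [one_mul, zero_mul, h0, sub_zero] at hi
    exact hi.symm

theorem aux_inv (L : ℝ →L[ℝ] ℝ) (h : L 1 ≠ 0) : L.IsInvertible := by
  refine ⟨ContinuousLinearEquiv.unitsEquivAut ℝ (Units.mk0 _ h), ?_⟩
  ext; simp

theorem aux_mul_deriv (g : ℝ → ℝ) (hg : ContinuousAt g 0) :
    HasDerivAt (fun m => m * g m) (g 0) 0 := by
  rw [hasDerivAt_iff_tendsto_slope]
  refine (hg.tendsto.mono_left nhdsWithin_le_nhds).congr' ?_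
  filter_upwards [self_mem_nhdsWithin] with m hm
  have : m ≠ 0 := hm
  simp [slope_def_field, this]

theorem aux_branch (f : ℝ × ℝ → ℝ) (r : ℕ) (n : ℕ) (hn : 1 ≤ n) (hr : r = n + 2)
    (hsmooth : ContDiff ℝ r f)
    (hf0 : f (0, 0) = 0)
    (hfx : deriv (fun x => f (x, 0)) 0 = 1)
    (s : ℝ) (hs : iteratedDeriv 2 (fun x => f (x, 0)) 0 * s ^ 2
      + 2 * deriv (fun μ => f (0, μ)) 0 = 0)
    (hs' : iteratedDeriv 2 (fun x => f (x, 0)) 0 * s ≠ 0) :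
    ∃ ψ : ℝ → ℝ, ContDiffAt ℝ n ψ 0 ∧ ψ 0 = s ∧
      ∀ᶠ m in nhds (0:ℝ), f (m * ψ m, m ^ 2) = m * ψ m := by
  have hdf : Differentiable ℝ f := hsmooth.differentiable (by norm_cast; omega)
  have hcd : ContDiff ℝ 1 (fderiv ℝ f) := hsmooth.fderiv_right (by norm_cast; omega)
  have hax : ∀ x, HasDerivAt (fun x => f (x, 0)) (fderiv ℝ f (x, 0) (1, 0)) x := fun x =>
    (hdf (x, 0)).hasFDerivAt.comp_hasDerivAt x
      ((hasDerivAt_id x).prodMk (hasDerivAt_const x (0:ℝ)))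
  have hbμ : HasDerivAt (fun μ => f (0, μ)) (fderiv ℝ f (0, 0) (0, 1)) 0 :=
    (hdf (0, 0)).hasFDerivAt.comp_hasDerivAt 0
      ((hasDerivAt_const (0:ℝ) (0:ℝ)).prodMk (hasDerivAt_id 0))
  rw [hbμ.deriv] at hs
  rw [(hax 0).deriv] at hfx
  -- a = f_x
  set a : ℝ × ℝ → ℝ := fun p => fderiv ℝ f p (1, 0) with ha
  set b : ℝ × ℝ → ℝ := fun p => fderiv ℝ f p (0, 1) with hb
  have hac : ContDiff ℝ 1 a := hcd.clm_apply contDiff_const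
  have hbc : ContDiff ℝ 1 b := hcd.clm_apply contDiff_const
  have hda : Differentiable ℝ a := hac.differentiable one_ne_zero
  have hxx : iteratedDeriv 2 (fun x => f (x, 0)) 0 = fderiv ℝ a (0, 0) (1, 0) := by
    rw [iteratedDeriv_succ, iteratedDeriv_one]
    have : deriv (fun x => f (x, 0)) = fun x => a (x, 0) := funext fun x => (hax x).deriv
    rw [this]
    have h2 : HasDerivAt (fun x : ℝ => (x, (0:ℝ))) (1, 0) 0 :=
      (hasDerivAt_id (0:ℝ)).prodMk (hasDerivAt_const (0:ℝ) (0:ℝ))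
    have h5 : HasFDerivAt a (fderiv ℝ a (0, 0)) ((fun x : ℝ => (x, (0:ℝ))) 0) :=
      (hda (0, 0)).hasFDerivAt
    exact (HasFDerivAt.comp_hasDerivAt (f := fun x : ℝ => (x, (0:ℝ))) 0 h5 h2).deriv
  rw [hxx] at hs hs'
  set A := fderiv ℝ a (0, 0) (1, 0)
  have hfx' : a (0, 0) = 1 := hfx
  -- blow-up
  let h : ℝ × ℝ → ℝ := fun p => f (p.1 * p.2, p.1 ^ 2) - p.1 * p.2
  have hh : ContDiff ℝ (n + 1 + 1 : ℕ) h := by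
    have : ContDiff ℝ (n + 1 + 1 : ℕ) f := by rw [← show r = n + 1 + 1 by omega]; exact hsmooth
    exact (this.comp (by fun_prop : ContDiff ℝ (n + 1 + 1 : ℕ)
      fun p : ℝ × ℝ => (p.1 * p.2, p.1 ^ 2))).sub (by fun_prop)
  have hH : ∀ y m, HasDerivAt (fun m => h (m, y))
      (y * a (m * y, m ^ 2) + 2 * m * b (m * y, m ^ 2) - y) m := by
    intro y m
    have h2 : HasDerivAt (fun m : ℝ => (m * y, m ^ 2)) (y, 2 * m) m :=
      (hasDerivAt_mul_const y).prodMk (by simpa using hasDerivAt_pow 2 m)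
    have h3 := ((hdf (m * y, m ^ 2)).hasFDerivAt.comp_hasDerivAt m h2).sub
      (hasDerivAt_mul_const (x := m) y)
    have h4 : ((y, 2 * m) : ℝ × ℝ) = y • (1, 0) + (2 * m) • (0, 1) := by simp
    rw [h4, map_add, map_smul, map_smul, smul_eq_mul, smul_eq_mul] at h3
    exact h3
  obtain ⟨k, hk, hhk⟩ := aux_hadamard (n + 1) h hh (by intro y; simp [h, hf0])
  have hk0 : ∀ y, k (0, y) = 0 := by
    intro y
    have h1 := aux_mul_deriv (fun m => k (m, y))
      (hk.continuous.comp (by fun_prop : Continuous fun m : ℝ => (m, y))).continuousAt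
    have h2 := hH y 0
    simp only [hhk] at h2
    have := h1.unique h2
    simpa [hfx'] using this
  obtain ⟨g, hg, hkg⟩ := aux_hadamard n k hk hk0
  have hdg : Differentiable ℝ g := hg.differentiable (by norm_cast; omega)
  have hcg : Continuous (fderiv ℝ g) := hg.continuous_fderiv (by norm_cast; omega)
  have hg0 : ∀ y, g (0, y) = (A * y ^ 2 + 2 * b (0, 0)) / 2 := by
    intro y
    have hgm : ∀ m, HasDerivAt (fun m => g (m, y)) (fderiv ℝ g (m, y) (1, 0)) m := fun m =>
      (hdg (m, y)).hasFDerivAt.comp_hasDerivAt m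
        ((hasDerivAt_id m).prodMk (hasDerivAt_const m y))
    have e1 : ∀ m, y * a (m * y, m ^ 2) + 2 * m * b (m * y, m ^ 2) - y
        = m * (2 * g (m, y) + m * fderiv ℝ g (m, y) (1, 0)) := by
      intro m
      have h2 := hH y m
      simp only [hhk, hkg] at h2
      have h3 := (hasDerivAt_id m).mul ((hasDerivAt_id m).mul (hgm m))
      have := h2.unique h3
      simp only [id] at this
      rw [this]; simp; ring
    have d1 := aux_mul_deriv (fun m => 2 * g (m, y) + m * fderiv ℝ g (m, y) (1, 0)) (by
      have := hg.continuous
      fun_prop)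
    have d2 : HasDerivAt (fun m : ℝ => a (m * y, m ^ 2)) (y * A) 0 := by
      have h2 : HasDerivAt (fun m : ℝ => (m * y, m ^ 2)) (y, 0) 0 :=
        (hasDerivAt_mul_const y).prodMk (by simpa using hasDerivAt_pow 2 (0:ℝ))
      have h5 : HasFDerivAt a (fderiv ℝ a (0, 0)) ((fun m : ℝ => (m * y, m ^ 2)) 0) := by
        simpa using (hda (0, 0)).hasFDerivAt
      have h3 := h5.comp_hasDerivAt 0 h2
      have h4 : ((y, 0) : ℝ × ℝ) = y • (1, 0) := by simp
      rw [h4, map_smul, smul_eq_mul] at h3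
      exact h3
    have d3 := aux_mul_deriv (fun m => 2 * b (m * y, m ^ 2)) (by
      have := hbc.continuous
      fun_prop)
    have d4 := ((d2.const_mul y).add d3).sub_const y
    have d5 := d4.congr_of_eventuallyEq (f₁ := fun m =>
      m * (2 * g (m, y) + m * fderiv ℝ g (m, y) (1, 0)))
      (Filter.Eventually.of_forall fun m => by
        simp only [Pi.add_apply]; rw [← e1]; ring)
    have := d1.unique d5
    simp at this
    linarith
  have hgs : g (0, s) = 0 := by rw [hg0]; simp [b, hs]
  have hgy : fderiv ℝ g (0, s) (0, 1) = A * s := by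
    have h1 : HasDerivAt (fun y => g (0, y)) (fderiv ℝ g (0, s) (0, 1)) s :=
      (hdg (0, s)).hasFDerivAt.comp_hasDerivAt s
        ((hasDerivAt_const s (0:ℝ)).prodMk (hasDerivAt_id s))
    simp only [hg0] at h1
    have h2 : HasDerivAt (fun y => (A * y ^ 2 + 2 * b (0, 0)) / 2) (A * (2 * s) / 2) s := by
      have := (((hasDerivAt_pow 2 s).const_mul A).add_const (2 * b (0, 0))).div_const 2
      simpa using this
    rw [h1.unique h2]; ring
  have hn0 : (n : WithTop ℕ∞) ≠ 0 := by norm_cast; omega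
  have cdg : ContDiffAt ℝ n g (0, s) := hg.contDiffAt
  have hinv : (fderiv ℝ g (0, s) ∘L .inr ℝ ℝ ℝ).IsInvertible :=
    aux_inv _ (by simpa [hgy] using hs')
  refine ⟨cdg.implicitFunction hn0 hinv, cdg.contDiffAt_implicitFunction hn0 hinv,
    cdg.implicitFunction_apply_self hn0 hinv, ?_⟩
  filter_upwards [cdg.eventually_apply_implicitFunction hn0 hinv] with m hm
  have h1 := hhk m (cdg.implicitFunction hn0 hinv m)
  rw [hkg, hm, hgs] at h1
  simp only [h, mul_zero] at h1
  linarith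

theorem aux_final (n : ℕ) (hn : 1 ≤ n) (ψ : ℝ → ℝ) (hψ : ContDiffAt ℝ n ψ 0) :
    ∃ C > 0, ∀ᶠ m in nhds (0:ℝ), |m * ψ m - ψ 0 * m| ≤ C * m ^ 2 := by
  have hd : DifferentiableAt ℝ ψ 0 := hψ.differentiableAt (by norm_cast; omega)
  obtain ⟨C, hC, hb⟩ := hd.isBigO_sub.exists_pos
  refine ⟨C, hC, ?_⟩
  filter_upwards [hb.bound] with m hm
  simp only [sub_zero, Real.norm_eq_abs] at hm
  rw [show m * ψ m - ψ 0 * m = m * (ψ m - ψ 0) by ring, abs_mul, ← sq_abs]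
  nlinarith [abs_nonneg m]

theorem saddle_node_fixed_point_expansions
    (f : ℝ × ℝ → ℝ) (r : ℕ) (hr : 3 ≤ r)
    (hsmooth : ContDiff ℝ r f)
    (hf0 : f (0, 0) = 0)
    (hfx : deriv (fun x => f (x, 0)) 0 = 1)
    (hfμ : deriv (fun μ => f (0, μ)) 0 > 0)
    (hfxx : iteratedDeriv 2 (fun x => f (x, 0)) 0 < 0) :
    ∃ m₀ > 0, ∃ x₁ x₂ : ℝ → ℝ, ∃ C > 0,
      ContDiffOn ℝ (r - 2) x₁ (Icc 0 m₀) ∧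
      ContDiffOn ℝ (r - 2) x₂ (Icc 0 m₀) ∧
      (∀ m ∈ Ioo (0 : ℝ) m₀,
        f (x₁ m, m ^ 2) = x₁ m ∧ f (x₂ m, m ^ 2) = x₂ m ∧ x₁ m < x₂ m) ∧
      (∀ m ∈ Icc (0 : ℝ) m₀,
        |x₁ m - (-(Real.sqrt (-2 * deriv (fun μ => f (0, μ)) 0
            / iteratedDeriv 2 (fun x => f (x, 0)) 0)) * m)| ≤ C * m ^ 2 ∧
        |x₂ m - Real.sqrt (-2 * deriv (fun μ => f (0, μ)) 0
            / iteratedDeriv 2 (fun x => f (x, 0)) 0) * m| ≤ C * m ^ 2) := by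
  obtain ⟨n, rfl⟩ : ∃ n, r = n + 2 := ⟨r - 2, by omega⟩
  have hn : 1 ≤ n := by omega
  have hcast : (((n + 2 : ℕ) : WithTop ℕ∞) - 2) = (n : WithTop ℕ∞) := by
    have : (((n + 2 : ℕ) : WithTop ℕ∞) - 2) = (((n + 2 : ℕ) - 2 : ℕ∞) : WithTop ℕ∞) := rfl
    rw [this]
    norm_cast
  rw [hcast]
  set B := deriv (fun μ => f (0, μ)) 0 with hB
  set A := iteratedDeriv 2 (fun x => f (x, 0)) 0 with hA
  set s := Real.sqrt (-2 * B / A) with hs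
  have hpos : 0 < -2 * B / A := div_pos_of_neg_of_neg (by linarith) hfxx
  have hspos : 0 < s := Real.sqrt_pos.2 hpos
  have hssq : s ^ 2 = -2 * B / A := Real.sq_sqrt hpos.le
  have hAne : A ≠ 0 := hfxx.ne
  have hq : A * s ^ 2 + 2 * B = 0 := by rw [hssq]; field_simp; ring
  obtain ⟨u, hu, hu0, huf⟩ := aux_branch f (n + 2) n hn rfl hsmooth hf0 hfx (-s)
    (by rw [neg_sq]; exact hq) (mul_ne_zero hAne (by linarith))
  obtain ⟨v, hv, hv0, hvf⟩ := aux_branch f (n + 2) n hn rfl hsmooth hf0 hfx s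
    hq (mul_ne_zero hAne hspos.ne')
  obtain ⟨C₁, hC₁, hb₁⟩ := aux_final n hn u hu
  obtain ⟨C₂, hC₂, hb₂⟩ := aux_final n hn v hv
  have hlt : ∀ᶠ m in nhds (0:ℝ), u m < v m :=
    hu.continuousAt.eventually_lt hv.continuousAt (by rw [hu0, hv0]; linarith)
  have hue := hu.eventually (by simp)
  have hve := hv.eventually (by simp)
  have hall := hue.and (hve.and (huf.and (hvf.and (hlt.and (hb₁.and hb₂)))))
  obtain ⟨ε, hε, hball⟩ := Metric.eventually_nhds_iff.1 hall
  have hmem : ∀ m ∈ Icc (0:ℝ) (ε / 2), dist m 0 < ε := by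
    intro m hm
    rw [Real.dist_0_eq_abs, abs_of_nonneg hm.1]
    linarith [hm.2]
  refine ⟨ε / 2, by linarith, fun m => m * u m, fun m => m * v m, max C₁ C₂,
    lt_max_of_lt_left hC₁, ?_, ?_, ?_, ?_⟩
  · intro m hm
    exact (contDiffAt_id.mul (hball (hmem m hm)).1).contDiffWithinAt
  · intro m hm
    exact (contDiffAt_id.mul (hball (hmem m hm)).2.1).contDiffWithinAt
  · intro m hm
    obtain ⟨-, -, h1, h2, h3, -, -⟩ := hball (hmem m ⟨hm.1.le, hm.2.le⟩)
    exact ⟨h1, h2, mul_lt_mul_of_pos_left h3 hm.1⟩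
  · intro m hm
    obtain ⟨-, -, -, -, -, h1, h2⟩ := hball (hmem m hm)
    rw [hu0] at h1
    rw [hv0] at h2
    exact ⟨h1.trans (by gcongr; exact le_max_left _ _),
      h2.trans (by gcongr; exact le_max_right _ _)⟩
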